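/- For all natural numbers a, b, c with a ≤ b ≤ c, G(a, b, c) = 0 if and only if one of the following holds: (i) a = b = c; (ii) a = b, c > a, and ν₂(c−a) is even; (iii) b = c, b > a, and ν₂(b−a) is even. -/

import Mathlib

namespace SharingNim

/-- The moves of three-pile Sharing Nim: take `k ≥ 1` tokens from one pile and add them to
another pile, provided the receiving pile has at most as many tokens as the source pile
after the move (i.e. `2 * k` is at most the difference of the two piles). -/
def moves : ℕ × ℕ × ℕ → Finset (ℕ × ℕ × ℕ)
  | (a, b, c) =>
    ((Finset.Icc 1 ((b - a) / 2)).image fun k => (a + k, b - k, c)) ∪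
    ((Finset.Icc 1 ((a - b) / 2)).image fun k => (a - k, b + k, c)) ∪
    ((Finset.Icc 1 ((c - a) / 2)).image fun k => (a + k, b, c - k)) ∪
    ((Finset.Icc 1 ((a - c) / 2)).image fun k => (a - k, b, c + k)) ∪
    ((Finset.Icc 1 ((c - b) / 2)).image fun k => (a, b + k, c - k)) ∪
    ((Finset.Icc 1 ((b - c) / 2)).image fun k => (a, b - k, c + k))

/-- The sum of squares of the pile sizes, a measure that strictly decreases along
every move. -/
def measure3 (p : ℕ × ℕ × ℕ) : ℕ := p.1 ^ 2 + p.2.1 ^ 2 + p.2.2 ^ 2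

theorem sq_move_lt {x y k : ℕ} (hk : 1 ≤ k) (h : k ≤ (y - x) / 2) :
    (x + k) ^ 2 + (y - k) ^ 2 < x ^ 2 + y ^ 2 := by
  have h1 : x + 2 * k ≤ y := by omega
  have h2 : k ≤ y := by omega
  zify [h2]
  nlinarith

theorem measure3_lt_of_mem_moves {q p : ℕ × ℕ × ℕ} (h : q ∈ moves p) :
    measure3 q < measure3 p := by
  obtain ⟨a, b, c⟩ := p
  simp only [moves, Finset.mem_union, Finset.mem_image, Finset.mem_Icc] at h
  rcases h with ((((⟨k, ⟨hk1, hk2⟩, rfl⟩ | ⟨k, ⟨hk1, hk2⟩, rfl⟩) | ⟨k, ⟨hk1, hk2⟩, rfl⟩) |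
      ⟨k, ⟨hk1, hk2⟩, rfl⟩) | ⟨k, ⟨hk1, hk2⟩, rfl⟩) | ⟨k, ⟨hk1, hk2⟩, rfl⟩ <;>
    simp only [measure3] <;>
    [linarith [sq_move_lt (x := a) (y := b) hk1 hk2];
     linarith [sq_move_lt (x := b) (y := a) hk1 hk2];
     linarith [sq_move_lt (x := a) (y := c) hk1 hk2];
     linarith [sq_move_lt (x := c) (y := a) hk1 hk2];
     linarith [sq_move_lt (x := b) (y := c) hk1 hk2];
     linarith [sq_move_lt (x := c) (y := b) hk1 hk2]]

/-- The minimum excludant of a finite set of naturals. -/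
noncomputable def mex (s : Finset ℕ) : ℕ := sInf {n : ℕ | n ∉ s}

/-- The Sprague–Grundy value of a position of three-pile Sharing Nim: the minimum
excludant of the Sprague–Grundy values of the positions reachable in one move. -/
noncomputable def G (p : ℕ × ℕ × ℕ) : ℕ :=
  mex ((moves p).attach.image fun q => G q.1)
termination_by measure3 p
decreasing_by exact measure3_lt_of_mem_moves q.2

def EV (n : ℕ) : Prop := Even (padicValNat 2 n)

theorem EV_zero : EV 0 := by simp [EV]

theorem EV_double {k : ℕ} (hk : 0 < k) : EV (2 * k) ↔ ¬ EV k := by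
  unfold EV
  rw [padicValNat.mul (by norm_num) (by omega), padicValNat.self (by norm_num), add_comm,
    Nat.even_add_one]

theorem exists_half {n : ℕ} (h : ¬ EV n) : ∃ k, 0 < k ∧ n = 2 * k ∧ EV k := by
  have h0 : n ≠ 0 := by rintro rfl; exact h EV_zero
  have h2 : 2 ∣ n := by
    by_contra h2
    exact h (by simp [EV, padicValNat.eq_zero_of_not_dvd h2])
  obtain ⟨k, rfl⟩ := h2
  have hk : 0 < k := by omega
  refine ⟨k, hk, rfl, ?_⟩
  rw [EV_double hk] at h
  exact not_not.mp h

/-- The symmetric form of the set of P-positions. -/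
def PP (a b c : ℕ) : Prop := ∃ d, EV d ∧
  ((a = b ∧ (c = a + d ∨ a = c + d)) ∨ (b = c ∧ (a = b + d ∨ b = a + d)) ∨
    (a = c ∧ (b = a + d ∨ a = b + d)))

theorem PP_swap12 {a b c : ℕ} (h : PP a b c) : PP b a c := by
  obtain ⟨d, hd, h⟩ := h
  exact ⟨d, hd, by omega⟩

theorem PP_swap23 {a b c : ℕ} (h : PP a b c) : PP a c b := by
  obtain ⟨d, hd, h⟩ := h
  exact ⟨d, hd, by omega⟩

theorem exists_k {a b c : ℕ} (hab : a ≤ b) (hbc : b ≤ c) (h : ¬ PP a b c) :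
    ∃ k, 1 ≤ k ∧ k ≤ (c - a) / 2 ∧ PP (a + k) b (c - k) := by
  by_cases h1 : a = b ∨ b = c
  · have h2 : ¬ EV (c - a) := fun h2 => h ⟨_, h2, by omega⟩
    obtain ⟨k, hk, hn, hE⟩ := exists_half h2
    exact ⟨k, hk, by omega, k, hE, by omega⟩
  · by_cases h2 : EV ((b - a) - (c - b) + ((c - b) - (b - a)))
    · rcases le_total (b - a) (c - b) with h3 | h3
      · exact ⟨b - a, by omega, by omega, _, h2, by omega⟩
      · exact ⟨c - b, by omega, by omega, _, h2, by omega⟩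
    · obtain ⟨k, hk, hn, hE⟩ := exists_half h2
      exact ⟨(c - a) / 2, by omega, by omega, k, hE, by omega⟩

theorem PP_no_move {a b c : ℕ} (h : PP a b c) {x y z : ℕ} (hq : (x, y, z) ∈ moves (a, b, c)) :
    ¬ PP x y z := by
  rintro ⟨e, he, h'⟩
  obtain ⟨d, hd, h⟩ := h
  have key : 0 < e ∧ d = 2 * e := by
    simp only [moves, Finset.mem_union, Finset.mem_image, Finset.mem_Icc, Prod.mk.injEq] at hq
    rcases hq with ((((⟨k, ⟨hk1, hk2⟩, rfl, rfl, rfl⟩ | ⟨k, ⟨hk1, hk2⟩, rfl, rfl, rfl⟩) |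
      ⟨k, ⟨hk1, hk2⟩, rfl, rfl, rfl⟩) | ⟨k, ⟨hk1, hk2⟩, rfl, rfl, rfl⟩) |
      ⟨k, ⟨hk1, hk2⟩, rfl, rfl, rfl⟩) | ⟨k, ⟨hk1, hk2⟩, rfl, rfl, rfl⟩ <;>
    rcases h with ⟨h, h | h⟩ | ⟨h, h | h⟩ | ⟨h, h | h⟩ <;> omega
  obtain ⟨he0, rfl⟩ := key
  exact (EV_double he0).mp hd he

theorem exists_move {a b c : ℕ} (h : ¬ PP a b c) :
    ∃ x y z, (x, y, z) ∈ moves (a, b, c) ∧ PP x y z := by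
  simp only [moves, Finset.mem_union, Finset.mem_image, Finset.mem_Icc]
  rcases le_total a b with h1 | h1 <;> rcases le_total b c with h2 | h2 <;>
    rcases le_total a c with h3 | h3
  · obtain ⟨k, hk, hk', hP⟩ := exists_k h1 h2 h
    exact ⟨_, _, _, .inl (.inl (.inl (.inr ⟨k, ⟨hk, hk'⟩, rfl⟩))), hP⟩
  · obtain ⟨k, hk, hk', hP⟩ := exists_k h1 h2 h
    exact ⟨_, _, _, .inl (.inl (.inl (.inr ⟨k, ⟨hk, hk'⟩, rfl⟩))), hP⟩
  · obtain ⟨k, hk, hk', hP⟩ := exists_k h3 h2 (fun h' => h (PP_swap23 h'))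
    exact ⟨_, _, _, .inl (.inl (.inl (.inl (.inl ⟨k, ⟨hk, hk'⟩, rfl⟩)))), PP_swap23 hP⟩
  · obtain ⟨k, hk, hk', hP⟩ := exists_k h3 h1 (fun h' => h (PP_swap23 (PP_swap12 h')))
    exact ⟨_, _, _, .inr ⟨k, ⟨hk, hk'⟩, rfl⟩, PP_swap23 (PP_swap12 hP)⟩
  · obtain ⟨k, hk, hk', hP⟩ := exists_k h1 h3 (fun h' => h (PP_swap12 h'))
    exact ⟨_, _, _, .inl (.inr ⟨k, ⟨hk, hk'⟩, rfl⟩), PP_swap12 hP⟩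
  · obtain ⟨k, hk, hk', hP⟩ := exists_k h2 h3 (fun h' => h (PP_swap12 (PP_swap23 h')))
    exact ⟨_, _, _, .inl (.inl (.inl (.inl (.inr ⟨k, ⟨hk, hk'⟩, rfl⟩)))), PP_swap12 (PP_swap23 hP)⟩
  · obtain ⟨k, hk, hk', hP⟩ := exists_k h2 h1
      (fun h' => h (PP_swap12 (PP_swap23 (PP_swap12 h'))))
    exact ⟨_, _, _, .inl (.inl (.inr ⟨k, ⟨hk, hk'⟩, rfl⟩)), PP_swap12 (PP_swap23 (PP_swap12 hP))⟩
  · obtain ⟨k, hk, hk', hP⟩ := exists_k h2 h1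
      (fun h' => h (PP_swap12 (PP_swap23 (PP_swap12 h'))))
    exact ⟨_, _, _, .inl (.inl (.inr ⟨k, ⟨hk, hk'⟩, rfl⟩)), PP_swap12 (PP_swap23 (PP_swap12 hP))⟩

theorem mex_eq_zero (s : Finset ℕ) : mex s = 0 ↔ 0 ∉ s := by
  unfold mex
  rw [Nat.sInf_eq_zero]
  constructor
  · rintro (h | h)
    · exact h
    · obtain ⟨n, hn⟩ := Infinite.exists_notMem_finset s
      have : n ∈ {n : ℕ | n ∉ s} := hn
      rw [h] at this
      exact this.elim
  · exact fun h => .inl h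

theorem G_eq_zero (p : ℕ × ℕ × ℕ) : G p = 0 ↔ ∀ q ∈ moves p, G q ≠ 0 := by
  rw [G, mex_eq_zero]
  simp

theorem G_zero_iff_PP : ∀ (n a b c : ℕ), measure3 (a, b, c) < n → (G (a, b, c) = 0 ↔ PP a b c) := by
  intro n
  induction n with
  | zero => intro a b c h; omega
  | succ n ih =>
    intro a b c hn
    have ih' : ∀ x y z, (x, y, z) ∈ moves (a, b, c) → (G (x, y, z) = 0 ↔ PP x y z) := by
      intro x y z hq
      have := measure3_lt_of_mem_moves hq
      exact ih x y z (by omega)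
    rw [G_eq_zero]
    constructor
    · intro h
      by_contra hP
      obtain ⟨x, y, z, hq, hP'⟩ := exists_move hP
      exact h _ hq ((ih' x y z hq).mpr hP')
    · rintro hP ⟨x, y, z⟩ hq h0
      exact PP_no_move hP hq ((ih' x y z hq).mp h0)

/-- For `a ≤ b ≤ c`, `G(a,b,c) = 0` iff `a = b = c`, or `a = b`, `c > a` and
`ν₂(c-a)` is even, or `b = c`, `b > a` and `ν₂(b-a)` is even. -/
theorem grundy_zero_iff (a b c : ℕ) (hab : a ≤ b) (hbc : b ≤ c) :
    G (a, b, c) = 0 ↔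
      (a = b ∧ b = c) ∨
      (a = b ∧ a < c ∧ Even (padicValNat 2 (c - a))) ∨
      (b = c ∧ a < b ∧ Even (padicValNat 2 (b - a))) := by
  rw [G_zero_iff_PP _ a b c (Nat.lt_succ_self _)]
  constructor
  · rintro ⟨d, hd, h⟩
    by_cases h0 : d = 0
    · left; omega
    · right
      by_cases h1 : a = b
      · left
        have : c - a = d := by omega
        exact ⟨h1, by omega, by rw [this]; exact hd⟩
      · right
        have : b - a = d := by omega
        exact ⟨by omega, by omega, by rw [this]; exact hd⟩
  · rintro (⟨h1, h2⟩ | ⟨h1, h2, h3⟩ | ⟨h1, h2, h3⟩)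
    · exact ⟨0, EV_zero, by omega⟩
    · exact ⟨_, h3, by omega⟩
    · exact ⟨_, h3, by omega⟩

end SharingNim
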